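/- For all real constants 0 ≤ α < 1, b > 1, c > 0, and b⁺ ≥ b there exists a constant C > 0 with the following property: for every simple, undirected, connected graph G with m edges and all distinct vertices s,t such that cheap_s(α) and cheap_t(α) are defined, s and t admit a b-expansion overlap of size at least c·d_α(s,t), and b⁺ is the highest expansion between s and t, there exists an exploration step k ∈ {0,...,d(s,t)} with meeting cost M(k) ≤ C·m^{1−ε}, where ε = c(1−α)/(log_b(b⁺)+c) > 0. -/

import Mathlib

open Finset

section Defs

variable {V : Type*} [Fintype V]

/-- The degree of vertex `u` in `G`. -/
noncomputable def deg (G : SimpleGraph V) (u : V) : ℕ := Nat.card (G.neighborSet u)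

/-- The number `m` of edges of `G`. -/
noncomputable def edgeCount (G : SimpleGraph V) : ℕ := Nat.card G.edgeSet

/-- The BFS layer `ℓ(v, i)`: vertices at distance exactly `i` from `v`. -/
noncomputable def layer (G : SimpleGraph V) (v : V) (i : ℕ) : Finset V :=
  Finset.univ.filter fun u => G.dist v u = i

/-- Exploration cost `c_s(i)` of exploration step `i` from `s`. -/
noncomputable def costS (G : SimpleGraph V) (s : V) (i : ℕ) : ℕ :=
  ∑ u ∈ layer G s (i - 1), deg G u

/-- Exploration cost `c_t(i)` of exploration step `i` from `t`
(for the start--destination pair `(s, t)`). -/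
noncomputable def costT (G : SimpleGraph V) (s t : V) (i : ℕ) : ℕ :=
  ∑ u ∈ layer G t (G.dist s t - i), deg G u

/-- Cost `c_s([i, j])` of the sequence of exploration steps `[i, j]` from `s`. -/
noncomputable def costSseq (G : SimpleGraph V) (s : V) (i j : ℕ) : ℕ :=
  ∑ k ∈ Finset.Icc i j, costS G s k

/-- Cost `c_t([i, j])` of the sequence of exploration steps `[i, j]` from `t`. -/
noncomputable def costTseq (G : SimpleGraph V) (s t : V) (i j : ℕ) : ℕ :=
  ∑ k ∈ Finset.Icc i j, costT G s t k

/-- The sequence of exploration steps `[i, j]` is `b`-expanding from `s`: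
`c_s(k+1) ≥ b · c_s(k)` for every `k ∈ [i, j)`. -/
def ExpandS (G : SimpleGraph V) (s : V) (b : ℝ) (i j : ℕ) : Prop :=
  ∀ k, i ≤ k → k < j → b * (costS G s k : ℝ) ≤ (costS G s (k + 1) : ℝ)

/-- The sequence of exploration steps `[i, j]` is `b`-expanding from `t`:
`c_t(k-1) ≥ b · c_t(k)` for every `k ∈ (i, j]`. -/
def ExpandT (G : SimpleGraph V) (s t : V) (b : ℝ) (i j : ℕ) : Prop :=
  ∀ k, i < k → k ≤ j → b * (costT G s t k : ℝ) ≤ (costT G s t (k - 1) : ℝ)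

/-- `e = expan_s(b)`: the latest step such that `[1, e]` is `b`-expanding from `s`. -/
def IsExpanS (G : SimpleGraph V) (s t : V) (b : ℝ) (e : ℕ) : Prop :=
  1 ≤ e ∧ e ≤ G.dist s t ∧ ExpandS G s b 1 e ∧
    ∀ e', e < e' → e' ≤ G.dist s t → ¬ ExpandS G s b 1 e'

/-- `e = expan_t(b)`: the smallest step such that `[e, d(s,t)]` is `b`-expanding from `t`. -/
def IsExpanT (G : SimpleGraph V) (s t : V) (b : ℝ) (e : ℕ) : Prop :=
  1 ≤ e ∧ e ≤ G.dist s t ∧ ExpandT G s t b e (G.dist s t) ∧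
    ∀ e', 1 ≤ e' → e' < e → ¬ ExpandT G s t b e' (G.dist s t)

/-- `cs = cheap_s(α)`: the latest step with `c_s([1, cs]) ≤ m^α`. -/
def IsCheapS (G : SimpleGraph V) (s t : V) (α : ℝ) (cs : ℕ) : Prop :=
  1 ≤ cs ∧ cs ≤ G.dist s t ∧
    (costSseq G s 1 cs : ℝ) ≤ (edgeCount G : ℝ) ^ α ∧
    ∀ j, cs < j → j ≤ G.dist s t →
      ¬ ((costSseq G s 1 j : ℝ) ≤ (edgeCount G : ℝ) ^ α)

/-- `ct = cheap_t(α)`: the smallest step with `c_t([ct, d(s,t)]) ≤ m^α`. -/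
def IsCheapT (G : SimpleGraph V) (s t : V) (α : ℝ) (ct : ℕ) : Prop :=
  1 ≤ ct ∧ ct ≤ G.dist s t ∧
    (costTseq G s t ct (G.dist s t) : ℝ) ≤ (edgeCount G : ℝ) ^ α ∧
    ∀ j, 1 ≤ j → j < ct →
      ¬ ((costTseq G s t j (G.dist s t) : ℝ) ≤ (edgeCount G : ℝ) ^ α)

/-- `B` bounds the expansion in every applicable exploration step between `s` and `t`:
no sequence of exploration steps is more than `B`-expanding from `s` or from `t`. -/
def ExpBound (G : SimpleGraph V) (s t : V) (B : ℝ) : Prop :=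
  (∀ k, 1 ≤ k → k + 1 ≤ G.dist s t → (costS G s (k + 1) : ℝ) ≤ B * (costS G s k : ℝ)) ∧
  (∀ k, 2 ≤ k → k ≤ G.dist s t → (costT G s t (k - 1) : ℝ) ≤ B * (costT G s t k : ℝ))

/-- `B` is the highest expansion between `s` and `t`: the smallest number such that
no sequence of exploration steps is more than `B`-expanding from `s` or from `t`. -/
def IsHighestExpansion (G : SimpleGraph V) (s t : V) (B : ℝ) : Prop :=
  ExpBound G s t B ∧ ∀ B', ExpBound G s t B' → B ≤ B'

/-- Meeting cost `M(k) = c_s([1, k]) + c_t([k+1, d(s,t)])` of the bidirectional BFS whose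
forward search performs `k` exploration steps and whose backward search performs the rest. -/
noncomputable def meetCost (G : SimpleGraph V) (s t : V) (k : ℕ) : ℕ :=
  costSseq G s 1 k + costTseq G s t (k + 1) (G.dist s t)

/-- `ρ = max{S₂, T₂} / min{S₁, T₁}` where `S₁ = expan_s`, `S₂ = cheap_t − expan_s − 1`,
`T₁ = d(s,t) − expan_t + 1`, `T₂ = expan_t − cheap_s − 1`, computed from
`d = d(s,t)`, `cs = cheap_s`, `ct = cheap_t`, `es = expan_s`, `et = expan_t`. -/
noncomputable def rho (d cs ct es et : ℕ) : ℝ :=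
  max ((ct : ℝ) - es - 1) ((et : ℝ) - cs - 1) / min (es : ℝ) ((d : ℝ) - et + 1)

end Defs
section Geometric

/-- A sequence growing by a factor of at most `B` has geometrically bounded partial sums. -/
lemma sum_Icc_le_of_le_mul {f : ℕ → ℝ} {A B : ℝ} {p d : ℕ} (hf : ∀ j, 0 ≤ f j) (hB : 1 < B)
    (hp : 1 ≤ p) (hA : ∑ j ∈ Icc 1 p, f j ≤ A)
    (hstep : ∀ j, 1 ≤ j → j + 1 ≤ d → f (j + 1) ≤ B * f j) (q : ℕ) (hpq : p ≤ q) (hq : q ≤ d) :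
    ∑ j ∈ Icc 1 q, f j ≤ A * B ^ (q - p) * (B / (B - 1)) := by
  have hB1 : 0 < B - 1 := by linarith
  have hA0 : 0 ≤ A := (Finset.sum_nonneg fun j _ => hf j).trans hA
  suffices h : ∀ i, p + i ≤ d → f (p + i) ≤ A * B ^ i ∧
      ∑ j ∈ Icc 1 (p + i), f j ≤ A * B ^ i * (B / (B - 1)) by
    obtain ⟨i, rfl⟩ := Nat.exists_eq_add_of_le hpq
    simpa using (h i hq).2
  intro i
  induction i with
  | zero =>
    intro _
    have h1 : 1 ≤ B / (B - 1) := by rw [le_div_iff₀ hB1]; linarith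
    refine ⟨?_, ?_⟩
    · have := Finset.single_le_sum (f := f) (fun j _ => hf j) (Finset.mem_Icc.2 ⟨hp, le_refl p⟩)
      simpa using this.trans hA
    · simpa using hA.trans (le_mul_of_one_le_right hA0 h1)
  | succ i ih =>
    intro hi
    obtain ⟨h1, h2⟩ := ih (by omega)
    have h3 : f (p + i + 1) ≤ A * B ^ (i + 1) := by
      calc f (p + i + 1) ≤ B * f (p + i) := hstep _ (by omega) hi
        _ ≤ B * (A * B ^ i) := by gcongr
        _ = A * B ^ (i + 1) := by ring
    refine ⟨h3, ?_⟩
    rw [← add_assoc, Finset.sum_Icc_succ_top (by omega)]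
    have h4 : A * B ^ (i + 1) * (B / (B - 1))
        = A * B ^ i * (B / (B - 1)) + A * B ^ (i + 1) := by
      field_simp
      ring
    linarith

/-- A sequence growing by a factor of at least `b` up to step `q` has geometrically small partial
sums before step `q`. -/
lemma sum_Icc_le_of_mul_le {f : ℕ → ℝ} {A b : ℝ} {q : ℕ} (hf : ∀ j, 0 ≤ f j) (hb : 1 < b)
    (hA : f q ≤ A) (hstep : ∀ j, 1 ≤ j → j < q → b * f j ≤ f (j + 1)) (k : ℕ) (hk : k ≤ q) :
    (∑ j ∈ Icc 1 k, f j) * b ^ (q - k) ≤ A * (b / (b - 1)) := by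
  have hb1 : 0 < b - 1 := by linarith
  have hA0 : 0 ≤ A := (hf q).trans hA
  have hsum : ∀ k, k ≤ q → ∑ j ∈ Icc 1 k, f j ≤ f k * (b / (b - 1)) := by
    intro k
    induction k with
    | zero =>
      intro _
      simpa using mul_nonneg (hf 0) (by positivity)
    | succ k ih =>
      intro hk
      rw [Finset.sum_Icc_succ_top (by omega)]
      have h4 : f (k + 1) * (b / (b - 1)) = f (k + 1) / (b - 1) + f (k + 1) := by
        field_simp
        ring
      rcases Nat.eq_zero_or_pos k with rfl | hk0
      · have : 0 ≤ f (0 + 1) / (b - 1) := div_nonneg (hf _) hb1.le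
        simp at h4 this ⊢
        linarith
      · have h5 : f k * (b / (b - 1)) ≤ f (k + 1) / (b - 1) := by
          rw [← mul_div_assoc]
          gcongr
          linarith [hstep k hk0 (by omega)]
        linarith [ih (by omega)]
  rcases Nat.eq_zero_or_pos k with rfl | hk0
  · simpa using mul_nonneg hA0 (by positivity)
  have hpow : ∀ i, k + i ≤ q → f k * b ^ i ≤ f (k + i) := by
    intro i
    induction i with
    | zero => simp
    | succ i ih =>
      intro hi
      calc f k * b ^ (i + 1) = b * (f k * b ^ i) := by ring
        _ ≤ b * f (k + i) := by gcongr; exact ih (by omega)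
        _ ≤ f (k + (i + 1)) := hstep _ (by omega) (by omega)
  have h6 : f k * b ^ (q - k) ≤ A := by
    have := hpow (q - k) (by omega)
    rw [Nat.add_sub_cancel' hk] at this
    exact this.trans hA
  calc (∑ j ∈ Icc 1 k, f j) * b ^ (q - k) ≤ f k * (b / (b - 1)) * b ^ (q - k) := by
        gcongr
        exact hsum k hk
    _ = f k * b ^ (q - k) * (b / (b - 1)) := by ring
    _ ≤ A * (b / (b - 1)) := by gcongr

end Geometric

section Graph

variable {V : Type*} [Fintype V] (G : SimpleGraph V)

lemma costS_le_two_mul_edgeCount (s : V) (i : ℕ) : costS G s i ≤ 2 * edgeCount G := by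
  classical
  have h : ∑ u, deg G u = 2 * edgeCount G := by
    simp only [deg, edgeCount, Nat.card_eq_fintype_card, SimpleGraph.card_neighborSet_eq_degree]
    rw [G.sum_degrees_eq_twice_card_edges, ← SimpleGraph.edgeFinset_card]
  rw [← h]
  exact Finset.sum_le_sum_of_subset (Finset.subset_univ _)

variable {G}

lemma one_le_edgeCount {s t : V} (hG : G.Connected) (hst : s ≠ t) : 1 ≤ edgeCount G := by
  classical
  have : Nontrivial V := ⟨s, t, hst⟩
  obtain ⟨u, hu⟩ := hG.preconnected.exists_adj_of_nontrivial s
  have : Nonempty G.edgeSet := ⟨⟨s(s, u), hu⟩⟩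
  exact Nat.card_pos

/-- Exploration from `t` is exploration from a source, with the steps counted in reverse. -/
lemma costT_eq_costS {s t : V} {i : ℕ} (hi : i ≤ G.dist s t) :
    costT G s t i = costS G t (G.dist s t + 1 - i) := by
  unfold costT costS
  congr 2
  omega

lemma costTseq_eq_costSseq {s t : V} {i : ℕ} (hi : 1 ≤ i) :
    costTseq G s t i (G.dist s t) = costSseq G t 1 (G.dist s t + 1 - i) := by
  refine Finset.sum_bij' (fun k _ => G.dist s t + 1 - k) (fun k _ => G.dist s t + 1 - k)
    ?_ ?_ ?_ ?_ ?_
  · intro k hk; rw [Finset.mem_Icc] at *; omega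
  · intro k hk; rw [Finset.mem_Icc] at *; omega
  · intro k hk; rw [Finset.mem_Icc] at hk; omega
  · intro k hk; rw [Finset.mem_Icc] at hk; omega
  · intro k hk
    rw [Finset.mem_Icc] at hk
    exact costT_eq_costS hk.2

lemma meetCost_eq (s t : V) (k : ℕ) : meetCost G s t k
    = costSseq G s 1 k + costSseq G t 1 (G.dist s t - k) := by
  rw [meetCost, costTseq_eq_costSseq (by omega), Nat.add_sub_add_right]

lemma ExpandT.expandS {s t : V} {b : ℝ} {e : ℕ} (he : 1 ≤ e)
    (h : ExpandT G s t b e (G.dist s t)) : ExpandS G t b 1 (G.dist s t + 1 - e) := by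
  intro k hk hke
  have := h (G.dist s t + 1 - k) (by omega) (by omega)
  rw [costT_eq_costS (by omega), costT_eq_costS (by omega)] at this
  convert this using 4 <;> omega

lemma ExpBound.costS_dest_le {s t : V} {B : ℝ} (h : ExpBound G s t B) (k : ℕ) (hk : 1 ≤ k)
    (hkd : k + 1 ≤ G.dist s t) : (costS G t (k + 1) : ℝ) ≤ B * (costS G t k : ℝ) := by
  have := h.2 (G.dist s t + 1 - k) (by omega) (by omega)
  rw [costT_eq_costS (by omega), costT_eq_costS (by omega)] at this
  convert this using 4 <;> omega

lemma costSseq_le_of_le_mul {s : V} {A B x : ℝ} {p q d : ℕ} (hB : 1 < B) (hp : 1 ≤ p)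
    (hA : (costSseq G s 1 p : ℝ) ≤ A)
    (hstep : ∀ k, 1 ≤ k → k + 1 ≤ d → (costS G s (k + 1) : ℝ) ≤ B * (costS G s k : ℝ))
    (hpq : p ≤ q) (hq : q ≤ d) (hx : (q : ℝ) - p ≤ x) :
    (costSseq G s 1 q : ℝ) ≤ A * B ^ x * (B / (B - 1)) := by
  have hB1 : 0 < B - 1 := by linarith
  have hA0 : 0 ≤ A := (Nat.cast_nonneg _).trans hA
  unfold costSseq at *
  push_cast at *
  refine (sum_Icc_le_of_le_mul (fun _ => Nat.cast_nonneg _) hB hp hA hstep q hpq hq).trans ?_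
  rw [← Real.rpow_natCast, Nat.cast_sub hpq]
  gcongr
  exact hB.le

lemma costSseq_le_of_expandS {s : V} {b x : ℝ} {k q : ℕ} (hb : 1 < b)
    (hexp : ExpandS G s b 1 q) (hk : k ≤ q) (hx : x ≤ (q : ℝ) - k) :
    (costSseq G s 1 k : ℝ) ≤ 2 * edgeCount G * b ^ (-x) * (b / (b - 1)) := by
  have hb0 : 0 < b := by linarith
  have hA : (costS G s q : ℝ) ≤ 2 * edgeCount G := by
    exact_mod_cast costS_le_two_mul_edgeCount G s q
  have h := sum_Icc_le_of_mul_le (f := fun j => (costS G s j : ℝ))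
    (fun _ => Nat.cast_nonneg _) hb hA hexp k hk
  rw [← Nat.cast_sum, ← Real.rpow_natCast, Nat.cast_sub hk] at h
  have h2 : (costSseq G s 1 k : ℝ) * b ^ x ≤ 2 * edgeCount G * (b / (b - 1)) := by
    refine le_trans ?_ h
    unfold costSseq
    gcongr
    exact hb.le
  rw [Real.rpow_neg hb0.le]
  have hbx : 0 < b ^ x := Real.rpow_pos_of_pos hb0 x
  calc (costSseq G s 1 k : ℝ) ≤ 2 * edgeCount G * (b / (b - 1)) / b ^ x :=
        (le_div_iff₀ hbx).2 h2
    _ = 2 * edgeCount G * (b ^ x)⁻¹ * (b / (b - 1)) := by ring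

end Graph

/-- Theorem 6: large relative expansion overlap.
For all constants `0 ≤ α < 1`, `b > 1`, `c > 0`, `b⁺ ≥ b` there is a constant `C > 0`
such that for every connected graph `G` and all distinct `s, t` for which `cheap_s(α)`,
`cheap_t(α)` are defined, `s` and `t` admit a `b`-expansion overlap of size at least
`c · d_α(s,t)`, and `b⁺` is the highest expansion between `s` and `t`, some exploration
step `k ∈ {0, ..., d(s,t)}` has meeting cost `M(k) ≤ C · m^{1-ε}` where
`ε = c(1-α)/(log_b(b⁺) + c) > 0`. -/
theorem stmt_7 (α b c bp : ℝ) (hα0 : 0 ≤ α) (hα1 : α < 1) (hb : 1 < b)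
    (hc : 0 < c) (hbp : b ≤ bp) :
    0 < c * (1 - α) / (Real.logb b bp + c) ∧
    ∃ C : ℝ, 0 < C ∧
      ∀ (V : Type) [Fintype V] (G : SimpleGraph V) (s t : V),
        G.Connected → s ≠ t →
        ∀ cs ct es et : ℕ, IsCheapS G s t α cs → IsCheapT G s t α ct →
          IsExpanS G s t b es → IsExpanT G s t b et → et ≤ es →
          c * ((ct : ℝ) - (cs : ℝ) - 1) ≤ (es : ℝ) - (et : ℝ) + 1 →
          IsHighestExpansion G s t bp →
          ∃ k ≤ G.dist s t,
            (meetCost G s t k : ℝ) ≤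
              C * (edgeCount G : ℝ) ^ (1 - c * (1 - α) / (Real.logb b bp + c)) := by
  have hb0 : 0 < b := by linarith
  have hbp1 : 1 < bp := by linarith
  have hbp0 : 0 < bp := by linarith
  have hL : 0 < Real.logb b bp := Real.logb_pos hb hbp1
  have hbL : b ^ Real.logb b bp = bp := Real.rpow_logb hb0 hb.ne' hbp0
  set L := Real.logb b bp
  have hLc : 0 < L + c := by linarith
  have hα : 0 < 1 - α := by linarith
  refine ⟨by positivity, ?_⟩
  set ε := c * (1 - α) / (L + c) with hε
  set γ := (1 - α) / (L + c) with hγ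
  have hγ0 : 0 < γ := by positivity
  have hcγ : c * γ = ε := by rw [hε, hγ]; ring
  have hLγ : α + L * γ = 1 - ε := by rw [hε, hγ]; field_simp; ring
  have hK1 : 0 < bp / (bp - 1) := div_pos hbp0 (by linarith)
  have hK2 : 0 < b / (b - 1) := div_pos hb0 (by linarith)
  refine ⟨2 + 2 * bp * (bp / (bp - 1)) + 4 * b * (b / (b - 1)), by positivity, ?_⟩
  intro V _ G s t hG hst cs ct es et hcs hct hes het hle hover hhigh
  obtain ⟨hcs1, hcsd, hcsm, -⟩ := hcs
  obtain ⟨hct1, hctd, hctm, -⟩ := hct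
  obtain ⟨-, hesd, hes, -⟩ := hes
  obtain ⟨het1, -, het, -⟩ := het
  have het' := het.expandS het1
  rw [costTseq_eq_costSseq hct1] at hctm
  have hm : (1 : ℝ) ≤ edgeCount G := by exact_mod_cast one_le_edgeCount hG hst
  set m : ℝ := (edgeCount G : ℝ)
  have hm0 : 0 < m := by linarith
  have hmε : 0 < m ^ (1 - ε) := Real.rpow_pos_of_pos hm0 _
  suffices h : ∃ k ≤ G.dist s t, (meetCost G s t k : ℝ) ≤ 2 * m ^ (1 - ε) ∨
      (meetCost G s t k : ℝ) ≤ 2 * bp * (bp / (bp - 1)) * m ^ (1 - ε) ∨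
      (meetCost G s t k : ℝ) ≤ 4 * b * (b / (b - 1)) * m ^ (1 - ε) by
    obtain ⟨k, hk, h⟩ := h
    refine ⟨k, hk, ?_⟩
    have h1 : 0 < bp * (bp / (bp - 1)) * m ^ (1 - ε) := by positivity
    have h2 : 0 < b * (b / (b - 1)) * m ^ (1 - ε) := by positivity
    rcases h with h | h | h <;> linarith
  simp only [meetCost_eq, Nat.cast_add]
  rcases Nat.lt_or_ge (cs + 1) ct with hlt | hge
  swap
  · refine ⟨cs, hcsd, Or.inl ?_⟩
    have hmono : costSseq G t 1 (G.dist s t - cs) ≤ costSseq G t 1 (G.dist s t + 1 - ct) :=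
      Finset.sum_le_sum_of_subset (Finset.Icc_subset_Icc_right (by omega))
    have hmono' : (costSseq G t 1 (G.dist s t - cs) : ℝ) ≤ m ^ α :=
      le_trans (by exact_mod_cast hmono) hctm
    have : m ^ α ≤ m ^ (1 - ε) :=
      Real.rpow_le_rpow_of_exponent_le hm (by rw [← hLγ]; nlinarith)
    linarith
  set D : ℝ := (ct : ℝ) - cs - 1 with hD
  rcases le_or_gt (b ^ (D / 2)) (m ^ γ) with hsmall | hlarge
  · obtain ⟨k, hk⟩ : ∃ k, k = (cs + ct) / 2 := ⟨_, rfl⟩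
    have hk1 : 2 * k ≤ cs + ct := by omega
    have hk2 : cs + ct ≤ 2 * k + 1 := by omega
    have hkd : k ≤ G.dist s t := by omega
    have hk1' : 2 * (k : ℝ) ≤ cs + ct := by exact_mod_cast hk1
    have hk2' : (cs + ct : ℝ) ≤ 2 * k + 1 := by exact_mod_cast hk2
    refine ⟨k, hkd, Or.inr (Or.inl ?_)⟩
    have hS := costSseq_le_of_le_mul (x := D / 2 + 1) (q := k) hbp1 hcs1 hcsm hhigh.1.1
      (by omega) hkd (by linarith)
    have hT := costSseq_le_of_le_mul (x := D / 2 + 1) (q := G.dist s t - k) hbp1 (by omega) hctm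
      hhigh.1.costS_dest_le (by omega) (Nat.sub_le _ _) (by
        rw [Nat.cast_sub hkd, Nat.cast_sub (by omega)]
        push_cast
        linarith)
    have hpow : m ^ α * bp ^ (D / 2 + 1) ≤ bp * m ^ (1 - ε) := by
      have h1 : bp ^ (D / 2) ≤ m ^ (L * γ) := by
        calc bp ^ (D / 2) = (b ^ (D / 2)) ^ L := by
              rw [← hbL, ← Real.rpow_mul hb0.le, ← Real.rpow_mul hb0.le, mul_comm]
          _ ≤ (m ^ γ) ^ L := by gcongr
          _ = m ^ (L * γ) := by rw [← Real.rpow_mul hm0.le, mul_comm]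
      rw [← hLγ, Real.rpow_add hm0, Real.rpow_add hbp0, Real.rpow_one]
      calc m ^ α * (bp ^ (D / 2) * bp) ≤ m ^ α * (m ^ (L * γ) * bp) := by gcongr
        _ = bp * (m ^ α * m ^ (L * γ)) := by ring
    have := mul_le_mul_of_nonneg_right hpow hK1.le
    linarith
  · obtain ⟨k, hk⟩ : ∃ k, k = (es + et) / 2 := ⟨_, rfl⟩
    have hk1 : 2 * k ≤ es + et := by omega
    have hk2 : es + et ≤ 2 * k + 1 := by omega
    have hkd : k ≤ G.dist s t := by omega
    have hk1' : 2 * (k : ℝ) ≤ es + et := by exact_mod_cast hk1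
    have hk2' : (es + et : ℝ) ≤ 2 * k + 1 := by exact_mod_cast hk2
    refine ⟨k, hkd, Or.inr (Or.inr ?_)⟩
    have hS := costSseq_le_of_expandS (x := c * D / 2 - 1) hb hes (k := k) (by omega)
      (by linarith)
    have hT := costSseq_le_of_expandS (x := c * D / 2 - 1) hb het' (k := G.dist s t - k)
      (by omega) (by
        rw [Nat.cast_sub hkd, Nat.cast_sub (by omega)]
        push_cast
        linarith)
    have hpow : m * b ^ (-(c * D / 2 - 1)) ≤ b * m ^ (1 - ε) := by
      have h1 : b ^ (-(c * D / 2)) ≤ m ^ (-ε) := by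
        calc b ^ (-(c * D / 2)) = (b ^ (D / 2)) ^ (-c) := by
              rw [← Real.rpow_mul hb0.le]
              ring_nf
          _ ≤ (m ^ γ) ^ (-c) :=
              Real.rpow_le_rpow_of_nonpos (Real.rpow_pos_of_pos hm0 _) hlarge.le (by linarith)
          _ = m ^ (-ε) := by rw [← Real.rpow_mul hm0.le, ← hcγ]; ring_nf
      rw [neg_sub, sub_eq_neg_add, Real.rpow_add hb0, sub_eq_add_neg 1 ε, Real.rpow_add hm0,
        Real.rpow_one, Real.rpow_one]
      calc m * (b ^ (-(c * D / 2)) * b) ≤ m * (m ^ (-ε) * b) := by gcongr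
        _ = b * (m * m ^ (-ε)) := by ring
    have := mul_le_mul_of_nonneg_right hpow hK2.le
    linarith
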